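/- Let (A, •, ∘) be an idempotent semicentral bigroupoid on a finite set A. Then for all a, b ∈ A there is exactly one element z ∈ A with z ∈ L_a and z ∈ R_b; that is, |L_a ∩ R_b| = 1. (This is the second axiom of a rectangular structure, so the pairs {(L_a, R_a) : a ∈ A} form a rectangular structure on A.) -/

import Mathlib

/-- `IsSCB mul cir` says that `(A, mul, cir)` is a semicentral bigroupoid:
`(a ∘ b) • (b ∘ c) = b` and `(a • b) ∘ (b • a) = b` for all `a b c`. -/
def IsSCB {A : Type*} (mul cir : A → A → A) : Prop :=
  (∀ a b c : A, mul (cir a b) (cir b c) = b) ∧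
  (∀ a b : A, cir (mul a b) (mul b a) = b)

/-- `Lset mul a = {x | ∃ y, x • y = a}`. -/
def Lset {A : Type*} (mul : A → A → A) (a : A) : Set A := {x | ∃ y, mul x y = a}

/-- `Rset mul a = {y | ∃ x, x • y = a}`. -/
def Rset {A : Type*} (mul : A → A → A) (a : A) : Set A := {y | ∃ x, mul x y = a}

namespace IsSCB

variable {A : Type*} {mul cir : A → A → A}

theorem cir_mem_Lset (h : IsSCB mul cir) (a b : A) : cir b a ∈ Lset mul a :=
  ⟨cir a b, h.1 b a b⟩

theorem cir_mem_Rset (h : IsSCB mul cir) (a b : A) : cir b a ∈ Rset mul b :=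
  ⟨cir a b, h.1 a b a⟩

theorem mul_cir_of_mem_Lset (h : IsSCB mul cir) {a z : A} (hz : z ∈ Lset mul a) (b : A) :
    mul z (cir a b) = a := by
  obtain ⟨y, rfl⟩ := hz
  have key := h.1 (mul y z) (mul z y) b
  rwa [h.2 y z] at key

theorem cir_mul_of_mem_Rset (h : IsSCB mul cir) {b z : A} (hz : z ∈ Rset mul b) (a : A) :
    mul (cir a b) z = b := by
  obtain ⟨x, rfl⟩ := hz
  have key := h.1 a (mul x z) (mul z x)
  rwa [h.2 x z] at key

theorem Lset_inter_Rset (h : IsSCB mul cir) (a b : A) :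
    Lset mul a ∩ Rset mul b = {cir b a} := by
  refine Set.eq_singleton_iff_unique_mem.2
    ⟨⟨h.cir_mem_Lset a b, h.cir_mem_Rset a b⟩, fun z hz => ?_⟩
  have key := h.2 (cir a b) z
  rw [h.mul_cir_of_mem_Lset hz.1, h.cir_mul_of_mem_Rset hz.2] at key
  exact key.symm

end IsSCB

/-- in a finite idempotent semicentral bigroupoid, for all `a b`
there is exactly one `z` with `z ∈ L_a` and `z ∈ R_b`; i.e. `|L_a ∩ R_b| = 1`. -/
theorem scb_rectangular_structure_axiom2 {A : Type*} [Fintype A]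
    (mul cir : A → A → A) (h : IsSCB mul cir)
    (hidem : ∀ a : A, mul a a = a) :
    ∀ a b : A, (∃! z : A, z ∈ Lset mul a ∧ z ∈ Rset mul b) ∧
      (Lset mul a ∩ Rset mul b).ncard = 1 := by
  intro a b
  have hab := h.Lset_inter_Rset a b
  refine ⟨⟨cir b a, ⟨h.cir_mem_Lset a b, h.cir_mem_Rset a b⟩, fun z hz => ?_⟩, ?_⟩
  · exact hab.subset hz
  · rw [hab, Set.ncard_singleton]
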